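/- Fix an integer l ≥ 2, an integer n, and d ∈ ℤ^{ℤ/lℤ} with Σ_{i∈ℤ/lℤ} d_i = n. Let λ be the unique l-core such that Res_l(λ) − d is an integer multiple of δ_l. Then d belongs to (ℤ^{ℤ/lℤ})_+ (i.e., d lies in the same W_l^aff-orbit as r·δ_l for some integer r ≥ 0) if and only if |λ| ≤ n. -/

import Mathlib

/-- The generator `s_j` of the affine Weyl group of type `Ã_{l-1}` acting (non-linearly)
on `ℤ^{ℤ/lℤ}`. -/
def sZ (l : ℕ) (j : ZMod l) (d : ZMod l → ℤ) : ZMod l → ℤ :=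
  fun i => if i = j then (if j = 0 then 1 else 0) + d (j + 1) + d (j - 1) - d j else d i

/-- `d` and `d'` lie in the same `W_l^aff`-orbit. -/
def SameOrbit (l : ℕ) (d d' : ZMod l → ℤ) : Prop :=
  ∃ js : List (ZMod l), d' = js.foldr (sZ l) d

/-- The `l`-residue of a box `(r, s)` of a Young diagram (0-based row `r`, column `s`). -/
def boxRes (l : ℕ) (c : ℕ × ℕ) : ZMod l := (c.2 : ZMod l) - (c.1 : ZMod l)

/-- `Res_l(λ) ∈ ℤ^{ℤ/lℤ}`. -/
def Res (l : ℕ) (lam : YoungDiagram) : ZMod l → ℤ :=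
  fun i => ((lam.cells.filter fun c => boxRes l c = i).card : ℤ)

/-- `λ` is an `l`-core. -/
def IsCore (l : ℕ) (lam : YoungDiagram) : Prop :=
  ¬ ∃ mu : YoungDiagram, mu ≤ lam ∧ (lam.cells \ mu.cells).card = l ∧
      Set.InjOn (boxRes l) ↑(lam.cells \ mu.cells)

/-- The box number `p` (counted from the top left) of the diagonal of content `k`. -/
def diagBox (k : ℤ) (p : ℕ) : ℕ × ℕ := (p + (-k).toNat, p + k.toNat)

theorem exists_diagBox_notMem (lam : YoungDiagram) (k : ℤ) : ∃ p, diagBox k p ∉ lam := by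
  refine ⟨lam.colLen 0, fun h => ?_⟩
  have h0 : (lam.colLen 0, 0) ∈ lam := lam.up_left_mem (Nat.le_add_right _ _) (Nat.zero_le _) h
  rw [YoungDiagram.mem_iff_lt_colLen] at h0
  exact lt_irrefl _ h0

open Classical in
/-- The number of boxes of content `k`. -/
noncomputable def diagLen (lam : YoungDiagram) (k : ℤ) : ℕ :=
  Nat.find (exists_diagBox_notMem lam k)

theorem diagBox_mem_iff (lam : YoungDiagram) (k : ℤ) (p : ℕ) :
    diagBox k p ∈ lam ↔ p < diagLen lam k := by
  classical
  constructor
  · intro h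
    by_contra hp
    have hspec : diagBox k (diagLen lam k) ∉ lam := Nat.find_spec (exists_diagBox_notMem lam k)
    have hle : diagLen lam k ≤ p := by omega
    exact hspec (lam.up_left_mem (by omega) (by omega) h)
  · intro h
    by_contra hp
    exact Nat.find_min (exists_diagBox_notMem lam k) h hp

theorem mem_iff_lt_diagLen (lam : YoungDiagram) (i j : ℕ) :
    (i, j) ∈ lam ↔ min i j < diagLen lam ((j : ℤ) - i) := by
  rw [← diagBox_mem_iff]
  have : diagBox ((j : ℤ) - i) (min i j) = (i, j) := by
    simp only [diagBox, Prod.mk.injEq]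
    omega
  rw [this]

theorem card_filter_content (lam : YoungDiagram) (k : ℤ) :
    (lam.cells.filter fun c => (c.2 : ℤ) - c.1 = k).card = diagLen lam k := by
  rw [← Finset.card_range (diagLen lam k)]
  refine Finset.card_nbij' (fun c => min c.1 c.2) (diagBox k) ?_ ?_ ?_ ?_
  · rintro ⟨i, j⟩ h
    simp only [Finset.coe_filter, YoungDiagram.mem_cells, Set.mem_ofPred_eq] at h
    simpa [← h.2] using (mem_iff_lt_diagLen lam i j).1 h.1
  · intro p h
    have h' := (diagBox_mem_iff lam k p).2 (by simpa using h)
    simp only [Finset.coe_filter, YoungDiagram.mem_cells, Set.mem_ofPred_eq]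
    refine ⟨h', ?_⟩
    simp only [diagBox]
    omega
  · rintro ⟨i, j⟩ h
    simp only [Finset.coe_filter, YoungDiagram.mem_cells, Set.mem_ofPred_eq] at h
    simp only [diagBox, Prod.mk.injEq]
    omega
  · intro p _
    simp only [diagBox]
    omega

/-- The indicator of the Maya diagram of `lam` (its vertical boundary steps). -/
noncomputable def bead (lam : YoungDiagram) (k : ℤ) : ℤ :=
  diagLen lam (k - 1) - diagLen lam k + if k ≤ 0 then 1 else 0

theorem diagLen_sub_one_of_pos (lam : YoungDiagram) {k : ℤ} (hk : 0 < k) :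
    diagLen lam k ≤ diagLen lam (k - 1) ∧ diagLen lam (k - 1) ≤ diagLen lam k + 1 := by
  constructor
  · by_contra! h
    have h1 := (diagBox_mem_iff lam k _).2 h
    have h2 : diagBox (k - 1) (diagLen lam (k - 1)) ∈ lam :=
      lam.up_left_mem (by omega) (by omega) h1
    exact lt_irrefl _ ((diagBox_mem_iff lam _ _).1 h2)
  · by_contra! h
    have h1 := (diagBox_mem_iff lam (k - 1) _).2 h
    have h2 : diagBox k (diagLen lam k) ∈ lam :=
      lam.up_left_mem (by omega) (by omega) h1
    exact lt_irrefl _ ((diagBox_mem_iff lam _ _).1 h2)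

theorem diagLen_sub_one_of_nonpos (lam : YoungDiagram) {k : ℤ} (hk : k ≤ 0) :
    diagLen lam (k - 1) ≤ diagLen lam k ∧ diagLen lam k ≤ diagLen lam (k - 1) + 1 := by
  constructor
  · by_contra! h
    have h1 := (diagBox_mem_iff lam (k - 1) _).2 h
    have h2 : diagBox k (diagLen lam k) ∈ lam :=
      lam.up_left_mem (by omega) (by omega) h1
    exact lt_irrefl _ ((diagBox_mem_iff lam _ _).1 h2)
  · by_contra! h
    have h1 := (diagBox_mem_iff lam k _).2 h
    have h2 : diagBox (k - 1) (diagLen lam (k - 1)) ∈ lam :=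
      lam.up_left_mem (by omega) (by omega) h1
    exact lt_irrefl _ ((diagBox_mem_iff lam _ _).1 h2)

theorem bead_eq_zero_or_one (lam : YoungDiagram) (k : ℤ) : bead lam k = 0 ∨ bead lam k = 1 := by
  unfold bead
  rcases le_or_gt k 0 with hk | hk
  · have := diagLen_sub_one_of_nonpos lam hk
    rw [if_pos hk]
    omega
  · have := diagLen_sub_one_of_pos lam hk
    rw [if_neg (not_le.2 hk)]
    omega

/-- A box of content `k` lies on the rim, with no box below it, if there is no bead at `k`. -/
theorem below_notMem_of_bead_eq_zero (lam : YoungDiagram) {i j : ℕ}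
    (hb : bead lam ((j : ℤ) - i) = 0) (hr : (i + 1, j + 1) ∉ lam) : (i + 1, j) ∉ lam := by
  rw [mem_iff_lt_diagLen] at hr ⊢
  unfold bead at hb
  have e1 : ((j + 1 : ℕ) : ℤ) - (i + 1 : ℕ) = j - i := by push_cast; ring
  have e2 : (j : ℤ) - (i + 1 : ℕ) = j - i - 1 := by push_cast; ring
  rw [e1] at hr
  rw [e2]
  split_ifs at hb <;> omega

/-- A box of content `k - 1` on the rim has no box to its right if there is a bead at `k`. -/
theorem right_notMem_of_bead_eq_one (lam : YoungDiagram) {i j : ℕ}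
    (hb : bead lam ((j : ℤ) - i + 1) = 1) (hr : (i + 1, j + 1) ∉ lam) : (i, j + 1) ∉ lam := by
  rw [mem_iff_lt_diagLen] at hr ⊢
  unfold bead at hb
  have e1 : ((j + 1 : ℕ) : ℤ) - (i + 1 : ℕ) = j - i := by push_cast; ring
  have e2 : ((j + 1 : ℕ) : ℤ) - i = j - i + 1 := by push_cast; ring
  rw [e1] at hr
  rw [e2]
  rw [add_sub_cancel_right] at hb
  split_ifs at hb <;> omega

theorem diagLen_pos_of_bead (lam : YoungDiagram) {a b k : ℤ} (ha : bead lam a = 0)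
    (hb : bead lam b = 1) (hak : a ≤ k) (hkb : k < b) : 0 < diagLen lam k := by
  unfold bead at ha hb
  rw [← diagBox_mem_iff]
  rcases le_or_gt 0 k with hk | hk
  · rw [if_neg (by omega)] at hb
    have h1 : diagBox (b - 1) 0 ∈ lam := by
      rw [diagBox_mem_iff]
      omega
    exact lam.up_left_mem (by omega) (by omega) h1
  · rw [if_pos (by omega)] at ha
    have h1 : diagBox a 0 ∈ lam := by
      rw [diagBox_mem_iff]
      omega
    exact lam.up_left_mem (by omega) (by omega) h1

/-- The boxes of the rim of `lam` with content in `[a, b)`. -/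
def rimStrip (lam : YoungDiagram) (a b : ℤ) : Finset (ℕ × ℕ) :=
  lam.cells.filter fun c => (c.1 + 1, c.2 + 1) ∉ lam ∧ a ≤ (c.2 : ℤ) - c.1 ∧ (c.2 : ℤ) - c.1 < b

theorem mem_rimStrip (lam : YoungDiagram) (a b : ℤ) (i j : ℕ) :
    (i, j) ∈ rimStrip lam a b ↔
      (i, j) ∈ lam ∧ (i + 1, j + 1) ∉ lam ∧ a ≤ (j : ℤ) - i ∧ (j : ℤ) - i < b := by
  simp [rimStrip]

theorem rimStrip_injOn (lam : YoungDiagram) (a b : ℤ) :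
    Set.InjOn (fun c : ℕ × ℕ => (c.2 : ℤ) - c.1) (rimStrip lam a b) := by
  rintro ⟨i, j⟩ h ⟨i', j'⟩ h' hc
  rw [Finset.mem_coe, mem_rimStrip] at h h'
  simp only at hc
  rcases lt_trichotomy i i' with hi | hi | hi
  · exact absurd (lam.up_left_mem (by omega) (by omega) h'.1) h.2.1
  · rw [Prod.mk.injEq]
    omega
  · exact absurd (lam.up_left_mem (by omega) (by omega) h.1) h'.2.1

theorem rimStrip_image (lam : YoungDiagram) {a b : ℤ} (ha : bead lam a = 0) (hb : bead lam b = 1) :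
    (rimStrip lam a b).image (fun c : ℕ × ℕ => (c.2 : ℤ) - c.1) = Finset.Ico a b := by
  ext k
  simp only [Finset.mem_image, Prod.exists, mem_rimStrip, Finset.mem_Ico]
  constructor
  · rintro ⟨i, j, h, rfl⟩
    exact h.2.2
  · rintro ⟨h1, h2⟩
    have hpos := diagLen_pos_of_bead lam ha hb h1 h2
    set p := diagLen lam k - 1
    have e : ((p + k.toNat : ℕ) : ℤ) - (p + (-k).toNat : ℕ) = k := by omega
    refine ⟨p + (-k).toNat, p + k.toNat, ⟨?_, ?_, ?_⟩, e⟩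
    · exact (diagBox_mem_iff lam k p).2 (by omega)
    · intro h
      have h' : diagBox k (p + 1) ∈ lam := by
        convert h using 1
        simp only [diagBox, Prod.mk.injEq]
        omega
      rw [diagBox_mem_iff] at h'
      omega
    · rw [e]
      exact ⟨h1, h2⟩

theorem isLowerSet_sdiff_rimStrip (lam : YoungDiagram) {a b : ℤ} (ha : bead lam a = 0)
    (hb : bead lam b = 1) :
    IsLowerSet (↑(lam.cells \ rimStrip lam a b) : Set (ℕ × ℕ)) := by
  rintro ⟨i', j'⟩ ⟨i, j⟩ ⟨hi, hj⟩ h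
  simp only [] at hi hj
  rw [Finset.mem_coe, Finset.mem_sdiff, YoungDiagram.mem_cells] at h ⊢
  refine ⟨lam.up_left_mem hi hj h.1, fun hs => h.2 ?_⟩
  rw [mem_rimStrip] at hs ⊢
  obtain ⟨_, hrim, h1, h2⟩ := hs
  have hrim' : (i' + 1, j' + 1) ∉ lam :=
    fun hm => hrim (lam.up_left_mem (by omega) (by omega) hm)
  have hor : i' = i ∨ j' = j := by
    by_contra! hne
    exact hrim (lam.up_left_mem (by omega) (by omega) h.1)
  refine ⟨h.1, hrim', ?_, ?_⟩
  · by_contra! hlt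
    obtain ⟨r, hr⟩ : ∃ r : ℕ, (j : ℤ) - r = a := ⟨((j : ℤ) - a).toNat, by omega⟩
    have hlow := below_notMem_of_bead_eq_zero lam (i := r) (j := j) (by rw [hr]; exact ha)
      (fun hm => hrim (lam.up_left_mem (by omega) (by omega) hm))
    exact hlow (lam.up_left_mem (by omega) (by omega) h.1)
  · by_contra! hlt
    obtain ⟨r, hr⟩ : ∃ r : ℕ, (r : ℤ) - i + 1 = b := ⟨(b + i - 1).toNat, by omega⟩
    have hright := right_notMem_of_bead_eq_one lam (i := i) (j := r) (by rw [hr]; exact hb)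
      (fun hm => hrim (lam.up_left_mem (by omega) (by omega) hm))
    exact hright (lam.up_left_mem (by omega) (by omega) h.1)

theorem IsCore.bead_eq_one {l : ℕ} {lam : YoungDiagram} (hcore : IsCore l lam) {a : ℤ}
    (hb : bead lam (a + l) = 1) : bead lam a = 1 := by
  by_contra hne
  have ha : bead lam a = 0 := (bead_eq_zero_or_one lam a).resolve_right hne
  have hsub : rimStrip lam a (a + l) ⊆ lam.cells := Finset.filter_subset _ _
  refine hcore ⟨⟨lam.cells \ rimStrip lam a (a + l), isLowerSet_sdiff_rimStrip lam ha hb⟩,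
    Finset.sdiff_subset, ?_, ?_⟩
  · rw [Finset.sdiff_sdiff_eq_self hsub, ← Finset.card_image_of_injOn (rimStrip_injOn lam a (a + l)),
      rimStrip_image lam ha hb, Int.card_Ico]
    omega
  · rw [Finset.sdiff_sdiff_eq_self hsub]
    rintro ⟨i, j⟩ h ⟨i', j'⟩ h' hc
    refine rimStrip_injOn lam a (a + l) h h' ?_
    rw [Finset.mem_coe, mem_rimStrip] at h h'
    have hc' : (((j : ℤ) - i : ℤ) : ZMod l) = (((j' : ℤ) - i' : ℤ) : ZMod l) := by
      push_cast
      exact hc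
    rw [ZMod.intCast_eq_intCast_iff_dvd_sub] at hc'
    have := Int.eq_zero_of_abs_lt_dvd hc' (by rw [abs_lt]; omega)
    simp only
    omega

theorem sum_zmod_eq_sum_range {l : ℕ} [NeZero l] (g : ZMod l → ℤ) :
    ∑ i, g i = ∑ t ∈ Finset.range l, g (t : ZMod l) := by
  refine Finset.sum_nbij' ZMod.val (fun t => (t : ZMod l)) ?_ ?_ ?_ ?_ ?_
  · intro i _
    simpa using ZMod.val_lt i
  · intro t _
    simp
  · intro i _
    simp
  · intro t ht
    exact ZMod.val_cast_of_lt (by simpa using ht)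
  · intro i _
    simp

/-- Twice the quadratic function on `ℤ^{ℤ/lℤ}` which is invariant under the affine Weyl group and
takes the value `r` on `r • δ`. -/
def energy (l : ℕ) [NeZero l] (d : ZMod l → ℤ) : ℤ :=
  2 * d 0 - ∑ i, (d i - d (i + 1)) ^ 2

theorem energy_sub_const (l : ℕ) [NeZero l] (d : ZMod l → ℤ) (c : ℤ) :
    energy l (fun i => d i - c) = energy l d - 2 * c := by
  simp only [energy, sub_sub_sub_cancel_right]
  ring

theorem energy_const (l : ℕ) [NeZero l] (r : ℤ) : energy l (fun _ => r) = 2 * r := by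
  simp [energy]

theorem energy_sZ (l : ℕ) [NeZero l] (hl : 2 ≤ l) (j : ZMod l) (d : ZMod l → ℤ) :
    energy l (sZ l j d) = energy l d := by
  have : Fact (1 < l) := ⟨hl⟩
  have h1 : j + 1 ≠ j := by simp
  have h2 : j - 1 ≠ j := by simp
  have key : ∀ f : ZMod l → ℤ, ∑ i, (f i - f (i + 1)) ^ 2 =
      (f j - f (j + 1)) ^ 2 + ((f (j - 1) - f j) ^ 2 +
        ∑ i ∈ (Finset.univ.erase j).erase (j - 1), (f i - f (i + 1)) ^ 2) := by
    intro f
    rw [← Finset.add_sum_erase Finset.univ _ (Finset.mem_univ j),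
      ← Finset.add_sum_erase (Finset.univ.erase j) _
        (Finset.mem_erase.2 ⟨h2, Finset.mem_univ (j - 1)⟩), sub_add_cancel]
  have hrest : ∑ i ∈ (Finset.univ.erase j).erase (j - 1), (sZ l j d i - sZ l j d (i + 1)) ^ 2 =
      ∑ i ∈ (Finset.univ.erase j).erase (j - 1), (d i - d (i + 1)) ^ 2 := by
    refine Finset.sum_congr rfl fun i hi => ?_
    simp only [Finset.mem_erase, Finset.mem_univ, and_true] at hi
    have h3 : i + 1 ≠ j := fun h => hi.1 (by rw [← h, add_sub_cancel_right])
    simp [sZ, hi.2, h3]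
  have hj : sZ l j d j = (if j = 0 then 1 else 0) + d (j + 1) + d (j - 1) - d j := by simp [sZ]
  have hj1 : sZ l j d (j + 1) = d (j + 1) := by simp [sZ]
  have hj2 : sZ l j d (j - 1) = d (j - 1) := by simp [sZ]
  unfold energy
  rw [key, key d, hrest, hj, hj1, hj2]
  by_cases h0 : j = 0
  · subst h0
    rw [hj, if_pos rfl]
    ring
  · have : sZ l j d 0 = d 0 := by simp [sZ, Ne.symm h0]
    rw [this, if_neg h0]
    ring

theorem SameOrbit.energy_eq {l : ℕ} [NeZero l] (hl : 2 ≤ l) {d d' : ZMod l → ℤ}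
    (h : SameOrbit l d d') : energy l d' = energy l d := by
  obtain ⟨js, rfl⟩ := h
  induction js with
  | nil => rfl
  | cons j js ih => rw [List.foldr_cons, energy_sZ l hl, ih]

theorem energy_le_two_mul_add (l : ℕ) [NeZero l] (d : ZMod l → ℤ) (i : ZMod l) :
    energy l d ≤ 2 * d i + l := by
  have hstep : ∀ t : ℕ, 2 * d 0 ≤ 2 * d (t : ZMod l) +
      ∑ s ∈ Finset.range t, ((d (s : ZMod l) - d ((s : ZMod l) + 1)) ^ 2 + 1) := by
    intro t
    induction t with
    | zero => simp
    | succ t ih =>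
      rw [Finset.sum_range_succ]
      push_cast
      nlinarith [sq_nonneg (d (t : ZMod l) - d ((t : ZMod l) + 1) - 1)]
  have hmono : ∑ s ∈ Finset.range i.val, ((d (s : ZMod l) - d ((s : ZMod l) + 1)) ^ 2 + 1) ≤
      ∑ s ∈ Finset.range l, ((d (s : ZMod l) - d ((s : ZMod l) + 1)) ^ 2 + 1) :=
    Finset.sum_le_sum_of_subset_of_nonneg
      (Finset.range_subset_range.2 (ZMod.val_lt i).le) fun _ _ _ => by positivity
  have h := hstep i.val
  rw [ZMod.natCast_zmod_val] at h
  rw [Finset.sum_add_distrib (s := Finset.range l)] at hmono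
  simp only [Finset.sum_const, Finset.card_range, nsmul_eq_mul, mul_one] at hmono
  rw [energy, sum_zmod_eq_sum_range]
  linarith

theorem eq_const_of_forall_le (l : ℕ) [NeZero l] (d : ZMod l → ℤ)
    (h : ∀ j, d j ≤ (if j = 0 then 1 else 0) + d (j + 1) + d (j - 1) - d j) :
    d = fun _ => d 0 := by
  have hl : 0 < l := NeZero.pos l
  set f : ℕ → ℤ := fun t => d (t : ZMod l) with hf
  have hfl : f l = f 0 := by simp [hf]
  have hconv : ∀ t, t + 1 < l → f (t + 1) - f t ≤ f (t + 2) - f (t + 1) := by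
    intro t ht
    have h1 := h ((t + 1 : ℕ) : ZMod l)
    have hne : ((t + 1 : ℕ) : ZMod l) ≠ 0 := by
      rw [Ne, ZMod.natCast_eq_zero_iff]
      exact Nat.not_dvd_of_pos_of_lt (by omega) ht
    rw [if_neg hne] at h1
    have e1 : ((t + 1 : ℕ) : ZMod l) + 1 = ((t + 2 : ℕ) : ZMod l) := by push_cast; ring
    have e2 : ((t + 1 : ℕ) : ZMod l) - 1 = (t : ZMod l) := by push_cast; ring
    rw [e1, e2] at h1
    simp only [hf]
    linarith
  have hwrap : f l - f (l - 1) ≤ f 1 - f 0 + 1 := by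
    have h1 := h 0
    have e : (0 : ZMod l) - 1 = ((l - 1 : ℕ) : ZMod l) := by
      rw [Nat.cast_sub hl]
      simp
    rw [if_pos rfl, e, zero_add] at h1
    simp only [hf, Nat.cast_one, Nat.cast_zero, ZMod.natCast_self]
    linarith
  have hmono : ∀ s t, s ≤ t → t < l → f (s + 1) - f s ≤ f (t + 1) - f t := by
    intro s t hst
    induction t, hst using Nat.le_induction with
    | base => exact fun _ => le_rfl
    | succ t _ ih => exact fun ht => (ih (by omega)).trans (hconv t ht)
  have h0 : 0 ≤ f 1 - f 0 := by
    by_contra! hneg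
    have hdec : ∀ t, t < l → f (t + 1) ≤ f 0 - 1 := by
      intro t
      induction t with
      | zero => intro _; rw [zero_add]; omega
      | succ t ih =>
        intro ht
        have h1 := ih (by omega)
        have h2 := hmono (t + 1) (l - 1) (by omega) (by omega)
        rw [Nat.sub_add_cancel hl] at h2
        linarith
    have := hdec (l - 1) (by omega)
    rw [Nat.sub_add_cancel hl, hfl] at this
    omega
  have hinc : ∀ s t, s ≤ t → t ≤ l → f s ≤ f t := by
    intro s t hst
    induction t, hst using Nat.le_induction with
    | base => exact fun _ => le_rfl
    | succ t _ ih =>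
      intro ht
      have h1 := ih (by omega)
      have h2 := hmono 0 t (by omega) (by omega)
      rw [zero_add] at h2
      linarith
  funext i
  have hi : f i.val = d i := by simp [hf]
  have h1 := hinc 0 i.val (by omega) (ZMod.val_lt i).le
  have h2 := hinc i.val l (ZMod.val_lt i).le le_rfl
  rw [← hi]
  have h3 : f 0 = d 0 := by simp [hf]
  linarith

theorem sum_sZ (l : ℕ) [NeZero l] (j : ZMod l) (d : ZMod l → ℤ) :
    ∑ i, sZ l j d i = ∑ i, d i + (sZ l j d j - d j) := by
  rw [← Finset.add_sum_erase Finset.univ (sZ l j d) (Finset.mem_univ j),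
    ← Finset.add_sum_erase Finset.univ d (Finset.mem_univ j)]
  have : ∑ i ∈ Finset.univ.erase j, sZ l j d i = ∑ i ∈ Finset.univ.erase j, d i :=
    Finset.sum_congr rfl fun i hi => by simp [sZ, Finset.ne_of_mem_erase hi]
  rw [this]
  ring

/-- Every orbit contains a constant function: lower the sum as long as possible. -/
theorem exists_sameOrbit_const (l : ℕ) [NeZero l] (hl : 2 ≤ l) (d : ZMod l → ℤ) :
    ∃ r : ℤ, SameOrbit l d (fun _ => r) := by
  have hbound : ∀ d : ZMod l → ℤ, l * (energy l d - l) ≤ 2 * ∑ i, d i := by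
    intro d
    have h := Finset.sum_le_sum fun (i : ZMod l) (_ : i ∈ Finset.univ) =>
      energy_le_two_mul_add l d i
    rw [Finset.sum_add_distrib, ← Finset.mul_sum] at h
    simp only [Finset.sum_const, Finset.card_univ, ZMod.card, nsmul_eq_mul] at h
    linarith
  induction hN : (2 * ∑ i, d i - l * (energy l d - l)).toNat using Nat.strong_induction_on
    generalizing d with
  | _ N ih =>
    by_cases h : ∀ j, d j ≤ (if j = 0 then 1 else 0) + d (j + 1) + d (j - 1) - d j
    · exact ⟨d 0, [], (eq_const_of_forall_le l d h).symm⟩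
    · push Not at h
      obtain ⟨j, hj⟩ := h
      have hs : sZ l j d j < d j := by simpa [sZ] using hj
      have hsum := sum_sZ l j d
      have hE := energy_sZ l hl j d
      have hb := hbound (sZ l j d)
      obtain ⟨r, js, hr⟩ := ih _ (by rw [← hN, hE]; rw [hE] at hb; omega) (sZ l j d) rfl
      exact ⟨r, js ++ [j], by simpa using hr⟩

theorem Res_natCast (l : ℕ) [NeZero l] (lam : YoungDiagram) (M : ℕ)
    (hM : ∀ c ∈ lam.cells, |(c.2 : ℤ) - c.1| < M) (t : ℕ) (ht : t ≤ l) :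
    Res l lam (t : ZMod l) =
      ∑ s ∈ Finset.range (2 * M), (diagLen lam (t + ((s : ℤ) - M) * l) : ℤ) := by
  have hl : (0 : ℤ) < l := by exact_mod_cast NeZero.pos l
  have hres : ∀ c : ℕ × ℕ, boxRes l c = (t : ZMod l) ↔ (l : ℤ) ∣ (c.2 : ℤ) - c.1 - t := by
    intro c
    rw [← ZMod.intCast_eq_intCast_iff_dvd_sub, eq_comm]
    simp [boxRes]
  unfold Res
  rw [Finset.card_eq_sum_card_fiberwise (t := Finset.range (2 * M))
    (f := fun c : ℕ × ℕ => (((c.2 : ℤ) - c.1 - t) / l + M).toNat)]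
  · push_cast
    refine Finset.sum_congr rfl fun s _ => ?_
    rw [← card_filter_content, Finset.filter_filter]
    congr 2
    refine Finset.filter_congr fun c hc => ?_
    rw [hres]
    have hM' := abs_lt.1 (hM c hc)
    constructor
    · rintro ⟨⟨m, hm⟩, h2⟩
      rw [hm, Int.mul_ediv_cancel_left _ hl.ne'] at h2
      have hm1 : -(M : ℤ) - 1 < m := by nlinarith
      have : m = s - M := by omega
      rw [← this]
      linarith
    · intro h
      have h3 : (c.2 : ℤ) - c.1 - t = l * (s - M) := by rw [h]; ring
      rw [h3, Int.mul_ediv_cancel_left _ hl.ne']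
      exact ⟨dvd_mul_right _ _, by omega⟩
  · intro c hc
    simp only [Finset.coe_filter, YoungDiagram.mem_cells, Set.mem_ofPred_eq, hres] at hc
    obtain ⟨hc, m, hm⟩ := hc
    have hM' := abs_lt.1 (hM c hc)
    simp only [Finset.coe_range, Set.mem_Iio]
    rw [hm, Int.mul_ediv_cancel_left _ hl.ne']
    have : m < M := by nlinarith
    omega

theorem sum_range_ite_lt {N K : ℕ} (h : N ≤ K) :
    ∑ s ∈ Finset.range K, (if s < N then (1 : ℤ) else 0) = N := by
  rw [Finset.sum_ite, Finset.sum_const_zero, add_zero, Finset.sum_const, nsmul_one]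
  have : (Finset.range K).filter (· < N) = Finset.range N := by
    ext s
    simp only [Finset.mem_filter, Finset.mem_range]
    omega
  rw [this, Finset.card_range]

theorem two_mul_sum_range_tsub {N K : ℕ} (h : N ≤ K) :
    2 * ∑ s ∈ Finset.range K, ((N - s : ℕ) : ℤ) = N * (N + 1) := by
  induction N with
  | zero => simp
  | succ N ih =>
    have h1 : ∀ s, ((N + 1 - s : ℕ) : ℤ) = (N - s : ℕ) + if s < N + 1 then 1 else 0 := by
      intro s
      split_ifs <;> omega
    simp only [h1]
    rw [Finset.sum_add_distrib, mul_add, ih (by omega), sum_range_ite_lt h]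
    push_cast
    ring

theorem diagLen_eq_zero (lam : YoungDiagram) (M : ℕ)
    (hM : ∀ c ∈ lam.cells, |(c.2 : ℤ) - c.1| < M) {k : ℤ} (hk : (M : ℤ) ≤ |k|) :
    diagLen lam k = 0 := by
  by_contra hne
  have h0 := (diagBox_mem_iff lam k 0).2 (Nat.pos_of_ne_zero hne)
  have h := hM _ ((YoungDiagram.mem_cells _).2 h0)
  have e : ((diagBox k 0).2 : ℤ) - (diagBox k 0).1 = k := by
    simp only [diagBox]
    omega
  rw [e] at h
  omega

/-- On each runner of the abacus of a core the beads are flush. -/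
theorem IsCore.exists_bead_eq {l : ℕ} (hl : 0 < l) {lam : YoungDiagram} (hcore : IsCore l lam)
    (M : ℕ) (hM : ∀ c ∈ lam.cells, |(c.2 : ℤ) - c.1| < M) (t : ℕ) :
    ∃ N : ℕ, N ≤ 2 * M ∧
      ∀ s : ℕ, bead lam (t + 1 + ((s : ℤ) - M) * l) = if s < N then 1 else 0 := by
  classical
  have hl' : (1 : ℤ) ≤ l := by exact_mod_cast hl
  have h2M : bead lam (t + 1 + (((2 * M : ℕ) : ℤ) - M) * l) = 0 := by
    have h1 : (M : ℤ) ≤ (((2 * M : ℕ) : ℤ) - M) * l := by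
      push_cast
      nlinarith
    unfold bead
    rw [diagLen_eq_zero lam M hM (by rw [abs_of_nonneg] <;> omega),
      diagLen_eq_zero lam M hM (by rw [abs_of_nonneg] <;> omega), if_neg (by omega)]
    simp
  have hex : ∃ s : ℕ, bead lam (t + 1 + ((s : ℤ) - M) * l) = 0 := ⟨_, h2M⟩
  refine ⟨Nat.find hex, Nat.find_min' hex h2M, fun s => ?_⟩
  split_ifs with hs
  · exact (bead_eq_zero_or_one _ _).resolve_left (Nat.find_min hex hs)
  · have hs' : Nat.find hex ≤ s := by omega
    clear hs
    induction s, hs' using Nat.le_induction with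
    | base => exact Nat.find_spec hex
    | succ s _ ih =>
      refine (bead_eq_zero_or_one _ _).resolve_right fun h => ?_
      have e : (t : ℤ) + 1 + (((s + 1 : ℕ) : ℤ) - M) * l = t + 1 + ((s : ℤ) - M) * l + l := by
        push_cast
        ring
      rw [e] at h
      have := hcore.bead_eq_one h
      omega

theorem IsCore.energy_Res {l : ℕ} [NeZero l] {lam : YoungDiagram} (hcore : IsCore l lam) :
    energy l (Res l lam) = 0 := by
  have hl : 0 < l := NeZero.pos l
  have hl' : (1 : ℤ) ≤ l := by exact_mod_cast hl
  obtain ⟨M, hM⟩ : ∃ M : ℕ, ∀ c ∈ lam.cells, |(c.2 : ℤ) - c.1| < M := by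
    refine ⟨lam.cells.sup (fun c => c.1 + c.2 + 1), fun c hc => ?_⟩
    have := Finset.le_sup (f := fun c : ℕ × ℕ => c.1 + c.2 + 1) hc
    rw [abs_lt]
    omega
  choose N hN hbead using hcore.exists_bead_eq hl M hM
  have hdiff : ∀ t < l, ∀ s : ℕ, (diagLen lam (t + ((s : ℤ) - M) * l) : ℤ) -
      diagLen lam ((t + 1 : ℕ) + ((s : ℤ) - M) * l) =
        (if s < N t then 1 else 0) - if s < M then 1 else 0 := by
    intro t ht s
    rw [← hbead, bead]
    have e : (t : ℤ) + 1 + ((s : ℤ) - M) * l - 1 = t + ((s : ℤ) - M) * l := by ring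
    have hiff : (t : ℤ) + 1 + ((s : ℤ) - M) * l ≤ 0 ↔ s < M := by
      have ht' : (t : ℤ) + 1 ≤ l := by exact_mod_cast ht
      constructor
      · intro h
        by_contra! hs
        have : (0 : ℤ) ≤ (s : ℤ) - M := by omega
        nlinarith
      · intro h
        have : (s : ℤ) - M ≤ -1 := by omega
        nlinarith
    rw [e]
    simp only [hiff]
    push_cast
    ring
  have hcharge : ∀ t < l, Res l lam (t : ZMod l) - Res l lam ((t : ZMod l) + 1) = N t - M := by
    intro t ht
    have e : (t : ZMod l) + 1 = ((t + 1 : ℕ) : ZMod l) := by push_cast; rfl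
    rw [e, Res_natCast l lam M hM t ht.le, Res_natCast l lam M hM (t + 1) ht,
      ← Finset.sum_sub_distrib, Finset.sum_congr rfl fun s _ => hdiff t ht s,
      Finset.sum_sub_distrib, sum_range_ite_lt (hN t), sum_range_ite_lt (by omega)]
  have hG : ∀ s : ℕ, (diagLen lam (((s : ℤ) - M) * l) : ℤ) =
      ∑ t ∈ Finset.range l, (((N t - s : ℕ) : ℤ) - (M - s : ℕ)) := by
    have hstep : ∀ s : ℕ, (diagLen lam (((s : ℤ) - M) * l) : ℤ) -
        diagLen lam ((((s + 1 : ℕ) : ℤ) - M) * l) =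
        ∑ t ∈ Finset.range l, (((N t - s : ℕ) : ℤ) - (M - s : ℕ)) -
        ∑ t ∈ Finset.range l, (((N t - (s + 1) : ℕ) : ℤ) - (M - (s + 1) : ℕ)) := by
      intro s
      have h1 := Finset.sum_range_sub' (fun t : ℕ => (diagLen lam (t + ((s : ℤ) - M) * l) : ℤ)) l
      rw [Finset.sum_congr rfl fun t ht => hdiff t (Finset.mem_range.1 ht) s] at h1
      have e : ((s + 1 : ℕ) - (M : ℤ)) * l = l + ((s : ℤ) - M) * l := by push_cast; ring
      rw [e, ← Finset.sum_sub_distrib]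
      simp only [Nat.cast_zero, zero_add] at h1
      rw [← h1]
      refine Finset.sum_congr rfl fun t _ => ?_
      split_ifs <;> omega
    have hconst : ∀ s : ℕ, (diagLen lam (((s : ℤ) - M) * l) : ℤ) -
        ∑ t ∈ Finset.range l, (((N t - s : ℕ) : ℤ) - (M - s : ℕ)) =
        diagLen lam ((((0 : ℕ) : ℤ) - M) * l) -
          ∑ t ∈ Finset.range l, (((N t - 0 : ℕ) : ℤ) - (M - 0 : ℕ)) := by
      intro s
      induction s with
      | zero => rfl
      | succ s ih =>
        have := hstep s
        linarith
    intro s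
    have h1 := hconst (2 * M)
    have h2 : ∑ t ∈ Finset.range l, (((N t - 2 * M : ℕ) : ℤ) - (M - 2 * M : ℕ)) = 0 :=
      Finset.sum_eq_zero fun t _ => by have := hN t; omega
    have h3 : diagLen lam ((((2 * M : ℕ) : ℤ) - M) * l) = 0 :=
      diagLen_eq_zero lam M hM (by
        push_cast
        rw [abs_of_nonneg] <;> nlinarith)
    rw [h2, h3] at h1
    have h4 := hconst s
    push_cast at h1 h4 ⊢
    linarith
  have hzero : ∑ t ∈ Finset.range l, ((N t : ℤ) - M) = 0 := by
    have h1 := hG 0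
    rw [diagLen_eq_zero lam M hM (by
      push_cast
      rw [abs_of_nonpos] <;> nlinarith)] at h1
    simpa using h1.symm
  have hRes0 : 2 * Res l lam 0 =
      ∑ t ∈ Finset.range l, ((N t : ℤ) * (N t + 1) - M * (M + 1)) := by
    have h1 := Res_natCast l lam M hM 0 (Nat.zero_le l)
    simp only [Nat.cast_zero, zero_add] at h1
    rw [h1, Finset.sum_congr rfl fun s _ => hG s, Finset.sum_comm, Finset.mul_sum]
    refine Finset.sum_congr rfl fun t _ => ?_
    rw [Finset.sum_sub_distrib, mul_sub, two_mul_sum_range_tsub (hN t),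
      two_mul_sum_range_tsub (by omega)]
  rw [energy, sum_zmod_eq_sum_range, hRes0, ← Finset.sum_sub_distrib]
  calc _ = ∑ t ∈ Finset.range l, (2 * (M : ℤ) + 1) * ((N t : ℤ) - M) :=
        Finset.sum_congr rfl fun t ht => by
          rw [hcharge t (Finset.mem_range.1 ht)]
          ring
    _ = 0 := by rw [← Finset.mul_sum, hzero, mul_zero]

theorem sum_Res (l : ℕ) [NeZero l] (lam : YoungDiagram) :
    ∑ i, Res l lam i = lam.cells.card := by
  unfold Res
  rw [Finset.card_eq_sum_card_fiberwise (f := boxRes l) (t := Finset.univ)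
    (fun _ _ => Finset.mem_coe.2 (Finset.mem_univ _))]
  push_cast
  rfl

/-- Let `d ∈ ℤ^{ℤ/lℤ}` with `Σ d_i = n` and let `λ` be the unique `l`-core with
`Res_l(λ) ≡ d mod ℤδ_l`. Then `d ∈ (ℤ^{ℤ/lℤ})_+` (it lies in the `W_l^aff`-orbit of
`r·δ_l` for some `r ≥ 0`) iff `|λ| ≤ n`. -/
theorem mem_plus_iff_core_card_le (l : ℕ) [NeZero l] (hl : 2 ≤ l) (n : ℤ)
    (d : ZMod l → ℤ) (hd : ∑ i : ZMod l, d i = n)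
    (lam : YoungDiagram) (hcore : IsCore l lam)
    (hres : ∃ c : ℤ, ∀ i : ZMod l, Res l lam i - d i = c) :
    (∃ r : ℤ, 0 ≤ r ∧ SameOrbit l d (fun _ => r)) ↔ (lam.cells.card : ℤ) ≤ n := by
  obtain ⟨c, hc⟩ := hres
  have hdc : d = fun i => Res l lam i - c := funext fun i => by linarith [hc i]
  have hE : energy l d = -2 * c := by
    rw [hdc, energy_sub_const, hcore.energy_Res]
    ring
  have hn : n = lam.cells.card - l * c := by
    rw [← hd, hdc, Finset.sum_sub_distrib, sum_Res]
    simp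
  have hl0 : (0 : ℤ) < l := by omega
  have hr : ∀ r : ℤ, SameOrbit l d (fun _ => r) → r = -c := by
    intro r h
    have := h.energy_eq hl
    rw [energy_const, hE] at this
    linarith
  constructor
  · rintro ⟨r, hr0, h⟩
    have := hr r h
    nlinarith
  · intro h
    obtain ⟨r, ho⟩ := exists_sameOrbit_const l hl d
    refine ⟨r, ?_, ho⟩
    rw [hr r ho]
    by_contra! hneg
    nlinarith
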